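/- arXiv:math/0609050 — 4 statements merged into one kernel-verified Lean document; each statement's English description precedes it below -/
import Mathlib

section
/- Let V ∈ C²(ℝⁿ) with ∫_{ℝⁿ} e^{−V(x)}dx = 1, and assume |∇V(x)|²/2 − ΔV(x) → +∞ as |x| → ∞. Then the probability measure μ with density e^{−V} satisfies a Poincaré inequality: there exists κ > 0 such that for every C¹ function h : ℝⁿ → ℝ with ∫h²dμ < ∞ and ∫|∇h|²dμ < ∞, ∫h²dμ − (∫h dμ)² ≤ κ^{−1} ∫|∇h|²dμ. -/
open MeasureTheory

/-- Partial derivative in the `i`-th coordinate direction of a scalar function on `ℝⁿ`. -/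
noncomputable def pd {n : ℕ} (i : Fin n) (g : EuclideanSpace ℝ (Fin n) → ℝ)
    (x : EuclideanSpace ℝ (Fin n)) : ℝ :=
  fderiv ℝ g x (EuclideanSpace.single i 1)

/-- The probability measure with density `e^{-V}` with respect to Lebesgue measure. -/
noncomputable def gibbs (n : ℕ) (V : EuclideanSpace ℝ (Fin n) → ℝ) :
    Measure (EuclideanSpace ℝ (Fin n)) :=
  volume.withDensity fun x => ENNReal.ofReal (Real.exp (-V x))

section LocalPoincare

variable {E : Type*} [NormedAddCommGroup E] [NormedSpace ℝ E]

theorem sq_sub_le_integral_segment {h : E → ℝ} (hh : ContDiff ℝ 1 h) (x y : E) :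
    (h x - h y) ^ 2 ≤
      ‖x - y‖ ^ 2 * ∫ t in (0 : ℝ)..1, ‖fderiv ℝ h (y + t • (x - y))‖ ^ 2 := by
  have hdf : Continuous (fderiv ℝ h) := hh.continuous_fderiv one_ne_zero
  set φ : ℝ → ℝ := fun t => fderiv ℝ h (y + t • (x - y)) (x - y) with hφ
  have hφc : Continuous φ := by fun_prop
  have hftc : ∫ t in (0 : ℝ)..1, φ t = h x - h y := by
    have hderiv : ∀ t ∈ Set.uIcc (0 : ℝ) 1,
        HasDerivAt (fun t : ℝ => h (y + t • (x - y))) (φ t) t := fun t _ => by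
      have hline : HasDerivAt (fun t : ℝ => y + t • (x - y)) (x - y) t := by
        simpa using ((hasDerivAt_id t).smul_const (x - y)).const_add y
      exact ((hh.differentiable one_ne_zero _).hasFDerivAt).comp_hasDerivAt t hline
    rw [intervalIntegral.integral_eq_sub_of_hasDerivAt hderiv (hφc.intervalIntegrable _ _)]
    simp
  set m := h x - h y
  have hvar : 0 ≤ ∫ t in (0 : ℝ)..1, (φ t - m) ^ 2 :=
    intervalIntegral.integral_nonneg zero_le_one fun t _ => sq_nonneg _
  have hexpand : ∫ t in (0 : ℝ)..1, (φ t - m) ^ 2 = (∫ t in (0 : ℝ)..1, φ t ^ 2) - m ^ 2 := by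
    have hpt : ∀ t, (φ t - m) ^ 2 = φ t ^ 2 - 2 * m * φ t + m ^ 2 := fun t => by ring
    simp_rw [hpt]
    rw [intervalIntegral.integral_add, intervalIntegral.integral_sub,
      intervalIntegral.integral_const_mul, hftc]
    · simp; ring
    all_goals exact Continuous.intervalIntegrable (by fun_prop) _ _
  have hle : ∫ t in (0 : ℝ)..1, φ t ^ 2 ≤
      ∫ t in (0 : ℝ)..1, ‖x - y‖ ^ 2 * ‖fderiv ℝ h (y + t • (x - y))‖ ^ 2 := by
    refine intervalIntegral.integral_mono zero_le_one
      (Continuous.intervalIntegrable (by fun_prop) _ _)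
      (Continuous.intervalIntegrable (by fun_prop) _ _) fun t => ?_
    rw [← mul_pow, mul_comm, ← sq_abs (φ t)]
    exact pow_le_pow_left₀ (abs_nonneg _) ((fderiv ℝ h _).le_opNorm _) 2
  rw [intervalIntegral.integral_const_mul] at hle
  linarith

variable [MeasurableSpace E] [BorelSpace E] [FiniteDimensional ℝ E] (μ : Measure E)
  [μ.IsAddHaarMeasure]

theorem lintegral_comp_smul_add {F : E → ENNReal} (hF : Measurable F) {r : ℝ} (hr : r ≠ 0)
    (a : E) : ∫⁻ x, F (r • x + a) ∂μ =
      ENNReal.ofReal |(r ^ Module.finrank ℝ E)⁻¹| * ∫⁻ x, F x ∂μ := by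
  rw [← lintegral_map (μ := μ) (f := fun z => F (z + a)) (g := fun x => r • x)
      (by fun_prop) (by fun_prop),
    Measure.map_addHaar_smul μ hr, lintegral_smul_measure, lintegral_add_right_eq_self]
  rfl

theorem lintegral_comp_smul_add_le {F : E → ENNReal} (hF : Measurable F) {r : ℝ}
    (hr : 1 / 2 ≤ r) (a : E) :
    ∫⁻ x, F (r • x + a) ∂μ ≤ 2 ^ Module.finrank ℝ E * ∫⁻ x, F x ∂μ := by
  rw [lintegral_comp_smul_add μ hF (by linarith) a]
  gcongr
  rw [← ENNReal.ofReal_ofNat 2, ← ENNReal.ofReal_pow (by norm_num)]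
  refine ENNReal.ofReal_le_ofReal ?_
  rw [abs_of_nonneg (by positivity), ← inv_pow]
  refine pow_le_pow_left₀ (by positivity) ?_ _
  rw [inv_le_comm₀ (by linarith) (by norm_num)]
  linarith

theorem lintegral_lintegral_segment_le {F : E → ENNReal} (hF : Measurable F) (s : Set E)
    (t : ℝ) [IsFiniteMeasure (μ.restrict s)] :
    ∫⁻ y in s, ∫⁻ x in s, F (y + t • (x - y)) ∂μ ∂μ ≤
      2 ^ Module.finrank ℝ E * (∫⁻ x, F x ∂μ) * μ s := by
  rcases le_total (1 / 2) t with ht | ht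
  · calc ∫⁻ y in s, ∫⁻ x in s, F (y + t • (x - y)) ∂μ ∂μ
        ≤ ∫⁻ _ in s, 2 ^ Module.finrank ℝ E * (∫⁻ x, F x ∂μ) ∂μ := by
          refine lintegral_mono fun y => (setLIntegral_le_lintegral _ _).trans ?_
          refine le_of_eq_of_le ?_ (lintegral_comp_smul_add_le μ hF ht (y - t • y))
          congr! 3
          module
      _ = _ := by simp
  · rw [lintegral_lintegral_swap (by fun_prop)]
    calc ∫⁻ x in s, ∫⁻ y in s, F (y + t • (x - y)) ∂μ ∂μ
        ≤ ∫⁻ _ in s, 2 ^ Module.finrank ℝ E * (∫⁻ x, F x ∂μ) ∂μ := by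
          refine lintegral_mono fun x => (setLIntegral_le_lintegral _ _).trans ?_
          refine le_of_eq_of_le ?_
            (lintegral_comp_smul_add_le μ hF (r := 1 - t) (by linarith) (t • x))
          congr! 3
          module
      _ = _ := by simp

theorem exists_setLIntegral_sq_sub_le {s : Set E} (hs : IsCompact s) (hconv : Convex ℝ s)
    (hpos : μ s ≠ 0) {h : E → ℝ} (hh : ContDiff ℝ 1 h) :
    ∃ y ∈ s, ∫⁻ x in s, ENNReal.ofReal ((h x - h y) ^ 2) ∂μ ≤
      ENNReal.ofReal (Metric.diam s ^ 2) * 2 ^ Module.finrank ℝ E *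
        ∫⁻ x in s, ENNReal.ofReal (‖fderiv ℝ h x‖ ^ 2) ∂μ := by
  have hdf : Continuous (fderiv ℝ h) := hh.continuous_fderiv one_ne_zero
  have hc : Continuous h := hh.continuous
  have hfin : μ s ≠ ⊤ := hs.measure_lt_top.ne
  have : IsFiniteMeasure (μ.restrict s) := ⟨by simpa using hs.measure_lt_top⟩
  have hsm : MeasurableSet s := hs.measurableSet
  set F : E → ENNReal := s.indicator fun x => ENNReal.ofReal (‖fderiv ℝ h x‖ ^ 2) with hFdef
  have hF : Measurable F := Measurable.indicator (by fun_prop) hsm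
  have hpt : ∀ y ∈ s, ∀ x ∈ s, ENNReal.ofReal ((h x - h y) ^ 2) ≤
      ENNReal.ofReal (Metric.diam s ^ 2) * ∫⁻ t in Set.Ioc (0 : ℝ) 1, F (y + t • (x - y)) := by
    intro y hy x hx
    have hint : ENNReal.ofReal (∫ t in (0 : ℝ)..1, ‖fderiv ℝ h (y + t • (x - y))‖ ^ 2) =
        ∫⁻ t in Set.Ioc (0 : ℝ) 1, F (y + t • (x - y)) := by
      have hcont : Continuous fun t : ℝ => ‖fderiv ℝ h (y + t • (x - y))‖ ^ 2 := by fun_prop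
      rw [intervalIntegral.integral_of_le zero_le_one, ofReal_integral_eq_lintegral_ofReal
        (hcont.integrableOn_Ioc) (Filter.Eventually.of_forall fun t => by positivity)]
      refine setLIntegral_congr_fun measurableSet_Ioc fun t ht => ?_
      simp only [hFdef]
      rw [Set.indicator_of_mem (hconv.add_smul_sub_mem hy hx ⟨ht.1.le, ht.2⟩)]
    rw [← hint, ← ENNReal.ofReal_mul (by positivity)]
    refine ENNReal.ofReal_le_ofReal ((sq_sub_le_integral_segment hh x y).trans ?_)
    have hdist : ‖x - y‖ ≤ Metric.diam s := by
      rw [← dist_eq_norm]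
      exact Metric.dist_le_diam_of_mem hs.isBounded hx hy
    have : 0 ≤ ∫ t in (0 : ℝ)..1, ‖fderiv ℝ h (y + t • (x - y))‖ ^ 2 :=
      intervalIntegral.integral_nonneg zero_le_one fun t _ => by positivity
    gcongr
  obtain ⟨y, hy, hle⟩ := exists_le_setLAverage (μ := μ) (s := s)
    (f := fun y => ∫⁻ x in s, ENNReal.ofReal ((h x - h y) ^ 2) ∂μ) hpos hfin
    (Measurable.aemeasurable (Measurable.lintegral_prod_right' (f := fun p : E × E =>
      ENNReal.ofReal ((h p.2 - h p.1) ^ 2)) (by fun_prop)))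
  refine ⟨y, hy, hle.trans ?_⟩
  rw [setLAverage_eq]
  refine ENNReal.div_le_of_le_mul ?_
  have hFs : ∫⁻ x, F x ∂μ = ∫⁻ x in s, ENNReal.ofReal (‖fderiv ℝ h x‖ ^ 2) ∂μ :=
    lintegral_indicator hsm _
  rw [← hFs]
  calc ∫⁻ y in s, ∫⁻ x in s, ENNReal.ofReal ((h x - h y) ^ 2) ∂μ ∂μ
      ≤ ∫⁻ y in s, ∫⁻ x in s, ENNReal.ofReal (Metric.diam s ^ 2) *
          (∫⁻ t in Set.Ioc (0 : ℝ) 1, F (y + t • (x - y))) ∂μ ∂μ :=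
        setLIntegral_mono' hsm fun y hy => setLIntegral_mono' hsm fun x hx => hpt y hy x hx
    _ = ENNReal.ofReal (Metric.diam s ^ 2) *
          ∫⁻ y in s, ∫⁻ x in s, (∫⁻ t in Set.Ioc (0 : ℝ) 1, F (y + t • (x - y))) ∂μ ∂μ := by
        simp_rw [lintegral_const_mul' _ _ ENNReal.ofReal_ne_top]
    _ = ENNReal.ofReal (Metric.diam s ^ 2) *
          ∫⁻ t in Set.Ioc (0 : ℝ) 1, ∫⁻ y in s, ∫⁻ x in s, F (y + t • (x - y)) ∂μ ∂μ := by
        congr 1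
        rw [lintegral_lintegral_swap (α := ℝ)]
        · refine lintegral_congr fun y => lintegral_lintegral_swap ?_
          fun_prop
        · refine Measurable.aemeasurable ?_
          refine Measurable.lintegral_prod_right' (f := fun p : (ℝ × E) × E =>
            F (p.1.2 + p.1.1 • (p.2 - p.1.2))) ?_
          fun_prop
    _ ≤ ENNReal.ofReal (Metric.diam s ^ 2) *
          ∫⁻ _ in Set.Ioc (0 : ℝ) 1, 2 ^ Module.finrank ℝ E * (∫⁻ x, F x ∂μ) * μ s := by
        gcongr with t
        exact lintegral_lintegral_segment_le μ hF s t
    _ = _ := by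
        simp
        ring

theorem exists_setIntegral_sq_sub_le {s : Set E} (hs : IsCompact s) (hconv : Convex ℝ s)
    (hpos : μ s ≠ 0) {h : E → ℝ} (hh : ContDiff ℝ 1 h) :
    ∃ c : ℝ, ∫ x in s, (h x - c) ^ 2 ∂μ ≤
      Metric.diam s ^ 2 * 2 ^ Module.finrank ℝ E * ∫ x in s, ‖fderiv ℝ h x‖ ^ 2 ∂μ := by
  obtain ⟨y, -, hle⟩ := exists_setLIntegral_sq_sub_le μ hs hconv hpos hh
  have hdf : Continuous (fderiv ℝ h) := hh.continuous_fderiv one_ne_zero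
  have hc : Continuous h := hh.continuous
  refine ⟨h y, ?_⟩
  have hi₁ : IntegrableOn (fun x => (h x - h y) ^ 2) s μ :=
    (Continuous.continuousOn (by fun_prop)).integrableOn_compact hs
  have hi₂ : IntegrableOn (fun x => ‖fderiv ℝ h x‖ ^ 2) s μ :=
    (Continuous.continuousOn (by fun_prop)).integrableOn_compact hs
  rw [← ofReal_integral_eq_lintegral_ofReal hi₁
      (Filter.Eventually.of_forall fun x => sq_nonneg _),
    ← ofReal_integral_eq_lintegral_ofReal hi₂
      (Filter.Eventually.of_forall fun x => by positivity),
    ← ENNReal.ofReal_ofNat 2, ← ENNReal.ofReal_pow (by norm_num),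
    ← ENNReal.ofReal_mul (by positivity), ← ENNReal.ofReal_mul (by positivity)] at hle
  refine (ENNReal.ofReal_le_ofReal_iff ?_).1 hle
  have : 0 ≤ ∫ x in s, ‖fderiv ℝ h x‖ ^ 2 ∂μ := integral_nonneg fun x => by positivity
  positivity

end LocalPoincare

section PartialDerivatives

variable {n : ℕ}

theorem ContDiff.pd {m k : WithTop ℕ∞} {g : EuclideanSpace ℝ (Fin n) → ℝ} (hg : ContDiff ℝ k g)
    (hmk : m + 1 ≤ k) (i : Fin n) : ContDiff ℝ m (pd i g) :=
  (hg.fderiv_right hmk).clm_apply contDiff_const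

theorem ContDiff.continuous_pd {g : EuclideanSpace ℝ (Fin n) → ℝ} (hg : ContDiff ℝ 1 g)
    (i : Fin n) : Continuous (_root_.pd i g) :=
  (ContDiff.pd (m := 0) hg (by norm_num) i).continuous

theorem HasCompactSupport.pd {g : EuclideanSpace ℝ (Fin n) → ℝ} (hg : HasCompactSupport g)
    (i : Fin n) : HasCompactSupport (pd i g) :=
  HasCompactSupport.fderiv_apply ℝ hg _

theorem HasFDerivAt.pd_eq {g : EuclideanSpace ℝ (Fin n) → ℝ} {x : EuclideanSpace ℝ (Fin n)}
    {g' : EuclideanSpace ℝ (Fin n) →L[ℝ] ℝ} (hg : HasFDerivAt g g' x) (i : Fin n) :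
    pd i g x = g' (EuclideanSpace.single i 1) := by
  rw [_root_.pd, hg.fderiv]

theorem pd_mul {f g : EuclideanSpace ℝ (Fin n) → ℝ} {x : EuclideanSpace ℝ (Fin n)}
    (hf : DifferentiableAt ℝ f x) (hg : DifferentiableAt ℝ g x) (i : Fin n) :
    pd i (fun y => f y * g y) x = f x * pd i g x + g x * pd i f x :=
  (hf.hasFDerivAt.mul hg.hasFDerivAt).pd_eq i

theorem pd_sub_const (g : EuclideanSpace ℝ (Fin n) → ℝ) (c : ℝ) (i : Fin n) :
    pd i (fun x => g x - c) = pd i g := by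
  ext x
  simp [pd, fderiv_sub_const]

theorem norm_fderiv_sq_le_sum_pd_sq (g : EuclideanSpace ℝ (Fin n) → ℝ)
    (x : EuclideanSpace ℝ (Fin n)) : ‖fderiv ℝ g x‖ ^ 2 ≤ ∑ i, pd i g x ^ 2 := by
  refine Real.le_sqrt (norm_nonneg _) (Finset.sum_nonneg fun i _ => sq_nonneg _) |>.1 ?_
  refine ContinuousLinearMap.opNorm_le_bound _ (Real.sqrt_nonneg _) fun v => ?_
  have hv : fderiv ℝ g x v = ∑ i, pd i g x * v i := by
    conv_lhs => rw [← (EuclideanSpace.basisFun (Fin n) ℝ).sum_repr v]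
    simp [pd, mul_comm]
  rw [hv, EuclideanSpace.norm_eq, Real.norm_eq_abs]
  refine Real.abs_le_sqrt (Finset.sum_mul_sq_le_sq_mul_sq _ _ _) |>.trans_eq ?_
  rw [Real.sqrt_mul (Finset.sum_nonneg fun i _ => sq_nonneg _)]
  simp

theorem integral_pd_eq_zero {u : EuclideanSpace ℝ (Fin n) → ℝ} (hu : ContDiff ℝ 1 u)
    (huc : HasCompactSupport u) (i : Fin n) : ∫ x, pd i u x = 0 := by
  have h := integral_mul_fderiv_eq_neg_fderiv_mul_of_integrable
    (μ := (volume : Measure (EuclideanSpace ℝ (Fin n)))) (f := fun _ => (1 : ℝ)) (g := u)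
    (v := EuclideanSpace.single i 1) (by simp)
    (by
      simp only [one_mul]
      exact (hu.continuous_pd i).integrable_of_hasCompactSupport (huc.pd i))
    (by simpa using hu.continuous.integrable_of_hasCompactSupport huc)
    (fun x _ => by fun_prop) (fun x _ => hu.differentiable one_ne_zero x)
  simpa [pd] using h

theorem integral_sq_mul_le_two_mul_integral_sum_pd_sq {V g : EuclideanSpace ℝ (Fin n) → ℝ}
    (hV : ContDiff ℝ 2 V) (hg : ContDiff ℝ 1 g) (hgc : HasCompactSupport g) :
    ∫ x, g x ^ 2 * ((∑ i, pd i V x ^ 2) / 2 - ∑ i, pd i (pd i V) x) * Real.exp (-V x) ≤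
      2 * ∫ x, (∑ i, pd i g x ^ 2) * Real.exp (-V x) := by
  have hV₁ : ContDiff ℝ 1 V := hV.of_le one_le_two
  have hdV : ∀ i, ContDiff ℝ 1 (pd i V) := fun i => hV.pd (by norm_num) i
  have hdVc : ∀ i, Continuous (pd i V) := fun i => (hdV i).continuous
  have hddVc : ∀ i, Continuous (pd i (pd i V)) := fun i => (hdV i).continuous_pd i
  have hdgc : ∀ i, Continuous (pd i g) := fun i => hg.continuous_pd i
  have hgcont := hg.continuous
  have hVcont := hV.continuous
  set u : Fin n → EuclideanSpace ℝ (Fin n) → ℝ :=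
    fun i x => g x * (g x * (pd i V x * Real.exp (-V x))) with hu_def
  have hu : ∀ i, ContDiff ℝ 1 (u i) := fun i =>
    hg.mul (hg.mul ((hdV i).mul (Real.contDiff_exp.comp hV₁.neg)))
  have huc : ∀ i, HasCompactSupport (u i) := fun i => hgc.mul_right
  have hpdu : ∀ i x, pd i (u i) x = (2 * g x * pd i g x * pd i V x
      + g x ^ 2 * pd i (pd i V) x - g x ^ 2 * pd i V x ^ 2) * Real.exp (-V x) := by
    intro i x
    have h₁ : DifferentiableAt ℝ g x := hg.differentiable one_ne_zero x
    have h₂ : DifferentiableAt ℝ (pd i V) x := (hdV i).differentiable one_ne_zero x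
    have h₃ : DifferentiableAt ℝ V x := hV₁.differentiable one_ne_zero x
    have hexp : pd i (fun y => Real.exp (-V y)) x = -(Real.exp (-V x) * pd i V x) := by
      rw [(h₃.hasFDerivAt.fun_neg.exp).pd_eq i]
      simp [pd]
    rw [hu_def, pd_mul h₁ (by fun_prop), pd_mul h₁ (by fun_prop), pd_mul h₂ (by fun_prop), hexp]
    ring
  have hsum : ∫ x, ∑ i, pd i (u i) x = 0 := by
    rw [integral_finsetSum _ fun i _ =>
      ((hu i).continuous_pd i).integrable_of_hasCompactSupport ((huc i).pd i)]
    exact Finset.sum_eq_zero fun i _ => integral_pd_eq_zero (hu i) (huc i) i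
  have hi₁ : Integrable fun x => ∑ i, pd i (u i) x := integrable_finsetSum _ fun i _ =>
    ((hu i).continuous_pd i).integrable_of_hasCompactSupport ((huc i).pd i)
  have hi₂ : Integrable fun x =>
      g x ^ 2 * ((∑ i, pd i V x ^ 2) / 2 - ∑ i, pd i (pd i V) x) * Real.exp (-V x) := by
    refine Continuous.integrable_of_hasCompactSupport (by fun_prop) ?_
    refine HasCompactSupport.mul_right (HasCompactSupport.mul_right ?_)
    simp_rw [pow_two]
    exact hgc.mul_right
  have hi₃ : Integrable fun x => (∑ i, pd i g x ^ 2) * Real.exp (-V x) := by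
    simp_rw [Finset.sum_mul]
    refine integrable_finsetSum _ fun i _ =>
      Continuous.integrable_of_hasCompactSupport (by fun_prop) ?_
    simp_rw [pow_two]
    exact ((hgc.pd i).mul_right).mul_right
  have hle : ∀ x, ∑ i, pd i (u i) x +
      g x ^ 2 * ((∑ i, pd i V x ^ 2) / 2 - ∑ i, pd i (pd i V) x) * Real.exp (-V x) ≤
        2 * ((∑ i, pd i g x ^ 2) * Real.exp (-V x)) := by
    intro x
    simp_rw [hpdu, ← Finset.sum_mul]
    rw [← add_mul, ← mul_assoc]
    refine mul_le_mul_of_nonneg_right ?_ (Real.exp_pos _).le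
    rw [mul_sub, Finset.mul_sum, Finset.mul_sum, Finset.sum_div, Finset.mul_sum,
      ← Finset.sum_sub_distrib, ← Finset.sum_add_distrib]
    refine Finset.sum_le_sum fun i _ => ?_
    nlinarith [sq_nonneg (2 * pd i g x - g x * pd i V x)]
  have := integral_mono (hi₁.add hi₂) (hi₃.const_mul 2) hle
  rw [integral_add' hi₁ hi₂, hsum, zero_add, integral_const_mul] at this
  exact this

theorem exists_cutoff (n : ℕ) {ε : ℝ} (hε : 0 < ε) (R : ℝ) :
    ∃ χ : EuclideanSpace ℝ (Fin n) → ℝ, ContDiff ℝ 1 χ ∧ HasCompactSupport χ ∧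
      (∀ x, 0 ≤ χ x) ∧ (∀ x, χ x ≤ 1) ∧ (∀ x ∈ Metric.closedBall 0 R, χ x = 1) ∧
      ∀ x, ∑ i, pd i χ x ^ 2 ≤ ε := by
  let f : ContDiffBump (0 : EuclideanSpace ℝ (Fin n)) := ⟨1, 2, one_pos, one_lt_two⟩
  have hf : ContDiff ℝ 1 f := f.contDiff
  have hcont : Continuous fun x => ∑ i, pd i f x ^ 2 := by
    have := fun i => hf.continuous_pd i
    fun_prop
  have hsupp : HasCompactSupport fun x => ∑ i, pd i f x ^ 2 := by
    refine f.hasCompactSupport.mono' fun x hx => ?_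
    by_contra hx'
    refine hx (Finset.sum_eq_zero fun i _ => ?_)
    have : fderiv ℝ f x = 0 := by
      by_contra hne
      exact hx' (support_fderiv_subset ℝ hne)
    simp [pd, this]
  obtain ⟨L, hL⟩ := hcont.bounded_above_of_compact_support hsupp
  obtain ⟨k, hk⟩ := Filter.eventually_atTop.1 ((Filter.eventually_ge_atTop (1 : ℝ)).and
    ((Filter.eventually_ge_atTop R).and (Filter.eventually_ge_atTop (L / ε))))
  obtain ⟨hk₁, hkR, hkL⟩ := hk k le_rfl
  have hk₀ : 0 < k := by linarith
  have hsmul : ContDiff ℝ 1 fun x : EuclideanSpace ℝ (Fin n) => k⁻¹ • x := by fun_prop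
  refine ⟨fun x => f (k⁻¹ • x), hf.comp hsmul, ?_, fun x => f.nonneg, fun x => f.le_one, ?_, ?_⟩
  · exact f.hasCompactSupport.comp_smul (inv_ne_zero hk₀.ne')
  · intro x hx
    refine f.one_of_mem_closedBall ?_
    rw [mem_closedBall_zero_iff] at hx ⊢
    rw [norm_smul, Real.norm_of_nonneg (by positivity)]
    change k⁻¹ * ‖x‖ ≤ 1
    rw [inv_mul_le_iff₀ hk₀]
    linarith
  · intro x
    have hpd : ∀ i, pd i (fun x => f (k⁻¹ • x)) x = k⁻¹ * pd i f (k⁻¹ • x) := by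
      intro i
      have h₁ : HasFDerivAt (fun x : EuclideanSpace ℝ (Fin n) => k⁻¹ • x)
          (k⁻¹ • ContinuousLinearMap.id ℝ _) x := (hasFDerivAt_id x).const_smul k⁻¹
      have h₂ := (hf.differentiable one_ne_zero (k⁻¹ • x)).hasFDerivAt.comp x h₁
      refine (HasFDerivAt.pd_eq h₂ i).trans ?_
      simp [pd]
    simp_rw [hpd, mul_pow, ← Finset.mul_sum]
    have hLx := (le_abs_self _).trans (hL (k⁻¹ • x))
    have hLk : L ≤ k ^ 2 * ε := by
      rw [div_le_iff₀ hε] at hkL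
      nlinarith [mul_pos hk₀ hε]
    rw [inv_pow, inv_mul_le_iff₀ (by positivity)]
    exact hLx.trans hLk

end PartialDerivatives

section Poincare

variable {n : ℕ}

theorem exists_weighted_local_poincare (V : EuclideanSpace ℝ (Fin n) → ℝ) (hV : Continuous V)
    {s : Set (EuclideanSpace ℝ (Fin n))} (hs : IsCompact s) (hconv : Convex ℝ s)
    (hpos : volume s ≠ 0) :
    ∃ C : ℝ, 0 ≤ C ∧ ∀ h : EuclideanSpace ℝ (Fin n) → ℝ, ContDiff ℝ 1 h →
      ∃ c : ℝ, ∫ x in s, (h x - c) ^ 2 * Real.exp (-V x) ≤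
        C * ∫ x in s, (∑ i, pd i h x ^ 2) * Real.exp (-V x) := by
  obtain ⟨M, hM⟩ := hs.exists_bound_of_continuousOn hV.continuousOn
  set P : ℝ := Metric.diam s ^ 2 * 2 ^ Module.finrank ℝ (EuclideanSpace ℝ (Fin n))
  have hP : 0 ≤ P := by positivity
  refine ⟨Real.exp M * (P * Real.exp M), by positivity, fun h hh => ?_⟩
  obtain ⟨c, hc⟩ := exists_setIntegral_sq_sub_le volume hs hconv hpos hh
  refine ⟨c, ?_⟩
  have hhc := hh.continuous
  have hpd := fun i => hh.continuous_pd i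
  have hdf : Continuous (fderiv ℝ h) := hh.continuous_fderiv one_ne_zero
  have hint : ∀ {f : EuclideanSpace ℝ (Fin n) → ℝ}, Continuous f → IntegrableOn f s :=
    fun hf => hf.continuousOn.integrableOn_compact hs
  have hweight : ∫ x in s, (h x - c) ^ 2 * Real.exp (-V x) ≤
      Real.exp M * ∫ x in s, (h x - c) ^ 2 := by
    rw [← integral_const_mul]
    refine setIntegral_mono_on (hint (by fun_prop)) (hint (by fun_prop)) hs.measurableSet
      fun x hx => ?_
    rw [mul_comm]
    gcongr
    exact (neg_le_abs _).trans (hM x hx)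
  have hgrad : ∫ x in s, ‖fderiv ℝ h x‖ ^ 2 ≤
      Real.exp M * ∫ x in s, (∑ i, pd i h x ^ 2) * Real.exp (-V x) := by
    rw [← integral_const_mul]
    refine setIntegral_mono_on (hint (by fun_prop)) (hint (by fun_prop)) hs.measurableSet
      fun x hx => ?_
    have hone : 1 ≤ Real.exp M * Real.exp (-V x) := by
      rw [← Real.exp_add, Real.one_le_exp_iff]
      linarith [(le_abs_self _).trans (hM x hx)]
    have hsum : 0 ≤ ∑ i, pd i h x ^ 2 := Finset.sum_nonneg fun i _ => sq_nonneg _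
    nlinarith [norm_fderiv_sq_le_sum_pd_sq h x]
  calc ∫ x in s, (h x - c) ^ 2 * Real.exp (-V x)
      ≤ Real.exp M * ∫ x in s, (h x - c) ^ 2 := hweight
    _ ≤ Real.exp M * (P * ∫ x in s, ‖fderiv ℝ h x‖ ^ 2) := by gcongr
    _ ≤ Real.exp M * (P * (Real.exp M *
          ∫ x in s, (∑ i, pd i h x ^ 2) * Real.exp (-V x))) := by gcongr
    _ = _ := by ring

theorem sum_pd_mul_sq_le {χ g : EuclideanSpace ℝ (Fin n) → ℝ} {x : EuclideanSpace ℝ (Fin n)}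
    {ε : ℝ} (hχ : DifferentiableAt ℝ χ x) (hg : DifferentiableAt ℝ g x) (h₀ : 0 ≤ χ x)
    (h₁ : χ x ≤ 1) (hε : ∑ i, pd i χ x ^ 2 ≤ ε) :
    ∑ i, pd i (fun y => χ y * g y) x ^ 2 ≤ 2 * ∑ i, pd i g x ^ 2 + 2 * ε * g x ^ 2 := by
  have hle : ∀ i, pd i (fun y => χ y * g y) x ^ 2 ≤
      2 * pd i g x ^ 2 + 2 * g x ^ 2 * pd i χ x ^ 2 := by
    intro i
    rw [pd_mul hχ hg]
    have hsq : χ x ^ 2 ≤ 1 := pow_le_one₀ h₀ h₁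
    nlinarith [sq_nonneg (χ x * pd i g x - g x * pd i χ x),
      mul_le_mul_of_nonneg_right hsq (sq_nonneg (pd i g x))]
  refine (Finset.sum_le_sum fun i _ => hle i).trans ?_
  rw [Finset.sum_add_distrib, ← Finset.mul_sum, ← Finset.mul_sum]
  nlinarith [sq_nonneg (g x)]

theorem integral_sq_le_of_lyapunov {V g : EuclideanSpace ℝ (Fin n) → ℝ} (hV : ContDiff ℝ 2 V)
    (hg : ContDiff ℝ 1 g) {s : Set (EuclideanSpace ℝ (Fin n))} (hs : MeasurableSet s) {K : ℝ}
    (hK : 0 ≤ K)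
    (hW : ∀ x, 1 ≤ ((∑ i, pd i V x ^ 2) / 2 - ∑ i, pd i (pd i V) x) + s.indicator (fun _ => K) x)
    (hi : Integrable fun x => g x ^ 2 * Real.exp (-V x))
    (hid : Integrable fun x => (∑ i, pd i g x ^ 2) * Real.exp (-V x)) :
    ∫ x, g x ^ 2 * Real.exp (-V x) ≤
      8 * (∫ x, (∑ i, pd i g x ^ 2) * Real.exp (-V x)) +
        2 * K * ∫ x in s, g x ^ 2 * Real.exp (-V x) := by
  have hdV : ∀ i, ContDiff ℝ 1 (pd i V) := fun i => hV.pd (by norm_num) i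
  have hdVc : ∀ i, Continuous (pd i V) := fun i => (hdV i).continuous
  have hddVc : ∀ i, Continuous (pd i (pd i V)) := fun i => (hdV i).continuous_pd i
  have hgcont := hg.continuous
  have hVcont := hV.continuous
  have hgd : Differentiable ℝ g := hg.differentiable one_ne_zero
  set I := ∫ x, g x ^ 2 * Real.exp (-V x)
  set G := ∫ x, (∑ i, pd i g x ^ 2) * Real.exp (-V x)
  set J := ∫ x in s, g x ^ 2 * Real.exp (-V x)
  have hball : ∀ R : ℕ, ∫ x in Metric.closedBall 0 (R : ℝ), g x ^ 2 * Real.exp (-V x) ≤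
      4 * G + I / 2 + K * J := by
    intro R
    obtain ⟨χ, hχ, hχc, hχ₀, hχ₁, hχR, hχd⟩ := exists_cutoff n (ε := 1 / 8) (by norm_num) R
    have hχcont := hχ.continuous
    have hf : ContDiff ℝ 1 fun x => χ x * g x := hχ.mul hg
    have hfc : HasCompactSupport fun x => χ x * g x := hχc.mul_right
    have hfpd := fun i => hf.continuous_pd i
    have hf2c : HasCompactSupport fun x => (χ x * g x) ^ 2 := by
      simp_rw [pow_two]
      exact hfc.mul_right
    have hi₁ : Integrable fun x => (χ x * g x) ^ 2 * Real.exp (-V x) :=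
      Continuous.integrable_of_hasCompactSupport (by fun_prop) hf2c.mul_right
    have hi₂ : Integrable fun x => (χ x * g x) ^ 2 *
        ((∑ i, pd i V x ^ 2) / 2 - ∑ i, pd i (pd i V) x) * Real.exp (-V x) :=
      Continuous.integrable_of_hasCompactSupport (by fun_prop) hf2c.mul_right.mul_right
    have hi₃ : Integrable fun x => (∑ i, pd i (fun y => χ y * g y) x ^ 2) * Real.exp (-V x) := by
      simp_rw [Finset.sum_mul]
      refine integrable_finsetSum _ fun i _ =>
        Continuous.integrable_of_hasCompactSupport (by fun_prop) ?_
      simp_rw [pow_two]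
      exact ((hfc.pd i).mul_right).mul_right
    have hiJ : Integrable (s.indicator fun x => g x ^ 2 * Real.exp (-V x)) := hi.indicator hs
    have hcut : ∫ x in Metric.closedBall 0 (R : ℝ), g x ^ 2 * Real.exp (-V x) ≤
        ∫ x, (χ x * g x) ^ 2 * Real.exp (-V x) := by
      rw [setIntegral_congr_fun (g := fun x => (χ x * g x) ^ 2 * Real.exp (-V x))
        measurableSet_closedBall fun x hx => by simp [hχR x hx]]
      exact setIntegral_le_integral hi₁ (Filter.Eventually.of_forall fun x => by positivity)
    have hlyap : ∫ x, (χ x * g x) ^ 2 * Real.exp (-V x) ≤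
        (∫ x, (χ x * g x) ^ 2 *
          ((∑ i, pd i V x ^ 2) / 2 - ∑ i, pd i (pd i V) x) * Real.exp (-V x)) + K * J := by
      have hJ : J = ∫ x, s.indicator (fun x => g x ^ 2 * Real.exp (-V x)) x :=
        (integral_indicator hs).symm
      rw [hJ, ← integral_const_mul, ← integral_add hi₂ (hiJ.const_mul K)]
      refine integral_mono hi₁ (hi₂.add (hiJ.const_mul K)) fun x => ?_
      have hexp := Real.exp_pos (-V x)
      have hsq : 0 ≤ (χ x * g x) ^ 2 * Real.exp (-V x) := by positivity
      have hle : (χ x * g x) ^ 2 * Real.exp (-V x) ≤ g x ^ 2 * Real.exp (-V x) := by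
        rw [mul_pow]
        gcongr
        exact mul_le_of_le_one_left (sq_nonneg _) (pow_le_one₀ (hχ₀ x) (hχ₁ x))
      have hWx := mul_le_mul_of_nonneg_right (hW x) hsq
      by_cases hx : x ∈ s
      · simp only [Set.indicator_of_mem hx] at hWx ⊢
        nlinarith
      · simp only [Set.indicator_of_notMem hx] at hWx ⊢
        nlinarith
    have hgrad : ∫ x, (∑ i, pd i (fun y => χ y * g y) x ^ 2) * Real.exp (-V x) ≤
        2 * G + 1 / 4 * I := by
      rw [← integral_const_mul, ← integral_const_mul,
        ← integral_add (hid.const_mul _) (hi.const_mul _)]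
      refine integral_mono hi₃ ((hid.const_mul _).add (hi.const_mul _)) fun x => ?_
      have := mul_le_mul_of_nonneg_right (sum_pd_mul_sq_le (hχ.differentiable one_ne_zero x)
        (hgd x) (hχ₀ x) (hχ₁ x) (hχd x)) (Real.exp_pos (-V x)).le
      linarith
    have := integral_sq_mul_le_two_mul_integral_sum_pd_sq hV hf hfc
    linarith
  have hlim : Filter.Tendsto
      (fun R : ℕ => ∫ x in Metric.closedBall 0 (R : ℝ), g x ^ 2 * Real.exp (-V x))
      Filter.atTop (nhds I) := by
    have := tendsto_setIntegral_of_monotone (μ := volume)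
      (s := fun R : ℕ => Metric.closedBall (0 : EuclideanSpace ℝ (Fin n)) R)
      (fun _ => measurableSet_closedBall)
      (fun a b hab => Metric.closedBall_subset_closedBall (by exact_mod_cast hab))
      hi.integrableOn
    rwa [Metric.iUnion_closedBall_nat, setIntegral_univ] at this
  have := le_of_tendsto' hlim hball
  linarith

theorem exists_lyapunov_bound {V : EuclideanSpace ℝ (Fin n) → ℝ} (hV : ContDiff ℝ 2 V)
    (htend : Filter.Tendsto
      (fun x => (∑ i, pd i V x ^ 2) / 2 - ∑ i, pd i (pd i V) x)
      (Filter.cocompact (EuclideanSpace ℝ (Fin n))) Filter.atTop) :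
    ∃ R K : ℝ, 0 < R ∧ 0 ≤ K ∧ ∀ x, 1 ≤ ((∑ i, pd i V x ^ 2) / 2 - ∑ i, pd i (pd i V) x) +
      (Metric.closedBall 0 R).indicator (fun _ => K) x := by
  have hdV : ∀ i, ContDiff ℝ 1 (pd i V) := fun i => hV.pd (by norm_num) i
  have hdVc : ∀ i, Continuous (pd i V) := fun i => (hdV i).continuous
  have hddVc : ∀ i, Continuous (pd i (pd i V)) := fun i => (hdV i).continuous_pd i
  have hev := htend.eventually_ge_atTop 1
  rw [← Metric.cobounded_eq_cocompact,
    (Metric.hasBasis_cobounded_compl_closedBall (0 : EuclideanSpace ℝ (Fin n))).eventually_iff]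
    at hev
  obtain ⟨R₀, -, hR₀⟩ := hev
  obtain ⟨M, hM⟩ := (isCompact_closedBall (0 : EuclideanSpace ℝ (Fin n))
    (max R₀ 1)).exists_bound_of_continuousOn
    (f := fun x => (∑ i, pd i V x ^ 2) / 2 - ∑ i, pd i (pd i V) x)
    (Continuous.continuousOn (by fun_prop))
  refine ⟨max R₀ 1, 1 + |M|, by positivity, by positivity, fun x => ?_⟩
  by_cases hx : x ∈ Metric.closedBall 0 (max R₀ 1)
  · rw [Set.indicator_of_mem hx]
    linarith [(neg_le_abs _).trans (hM x hx), le_abs_self M]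
  · rw [Set.indicator_of_notMem hx, add_zero]
    exact hR₀ fun hx' => hx (Metric.closedBall_subset_closedBall (le_max_left _ _) hx')

theorem integral_gibbs {V : EuclideanSpace ℝ (Fin n) → ℝ} (hV : Continuous V)
    (f : EuclideanSpace ℝ (Fin n) → ℝ) :
    ∫ x, f x ∂gibbs n V = ∫ x, f x * Real.exp (-V x) := by
  rw [gibbs, integral_withDensity_eq_integral_toReal_smul (by fun_prop) (by simp)]
  simp [ENNReal.toReal_ofReal (Real.exp_pos _).le, mul_comm]

theorem integrable_gibbs_iff {V : EuclideanSpace ℝ (Fin n) → ℝ} (hV : Continuous V)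
    (f : EuclideanSpace ℝ (Fin n) → ℝ) :
    Integrable f (gibbs n V) ↔ Integrable fun x => f x * Real.exp (-V x) := by
  rw [gibbs, integrable_withDensity_iff (by fun_prop) (by simp)]
  simp [ENNReal.toReal_ofReal (Real.exp_pos _).le]

theorem isProbabilityMeasure_gibbs {V : EuclideanSpace ℝ (Fin n) → ℝ}
    (hnorm : (∫ x, Real.exp (-V x)) = 1) : IsProbabilityMeasure (gibbs n V) := by
  refine ⟨?_⟩
  have hi : Integrable fun x => Real.exp (-V x) := by
    by_contra hi
    simp [integral_undef hi] at hnorm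
  rw [gibbs, withDensity_apply _ MeasurableSet.univ, Measure.restrict_univ,
    ← ofReal_integral_eq_lintegral_ofReal hi
      (Filter.Eventually.of_forall fun x => (Real.exp_pos _).le), hnorm, ENNReal.ofReal_one]

theorem integral_sq_sub_sq_integral_le {Ω : Type*} [MeasurableSpace Ω] {μ : Measure Ω}
    [IsProbabilityMeasure μ] {h : Ω → ℝ} (hh : MemLp h 2 μ) (c : ℝ) :
    ∫ x, h x ^ 2 ∂μ - (∫ x, h x ∂μ) ^ 2 ≤ ∫ x, (h x - c) ^ 2 ∂μ := by
  have hi : Integrable h μ := hh.integrable one_le_two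
  have hexpand : ∫ x, (h x - c) ^ 2 ∂μ = ∫ x, h x ^ 2 ∂μ - 2 * c * ∫ x, h x ∂μ + c ^ 2 := by
    have hpt : ∀ x, (h x - c) ^ 2 = h x ^ 2 - 2 * c * h x + c ^ 2 := fun x => by ring
    simp_rw [hpt]
    rw [integral_add (f := fun x => h x ^ 2 - 2 * c * h x)
        (hh.integrable_sq.sub (hi.const_mul _)) (integrable_const _),
      integral_sub hh.integrable_sq (hi.const_mul _), integral_const_mul]
    simp
  nlinarith [sq_nonneg (∫ x, h x ∂μ - c)]

end Poincare

/-- The Deuschel–Stroock criterion: if `V ∈ C²(ℝⁿ)` with `∫ e^{-V} = 1` and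
`|∇V|²/2 - ΔV → +∞` as `|x| → ∞`, then `e^{-V} dx` satisfies a Poincaré inequality. -/
theorem poincare_of_deuschel_stroock
    (n : ℕ) (V : EuclideanSpace ℝ (Fin n) → ℝ)
    (hV : ContDiff ℝ 2 V)
    (hnorm : (∫ x, Real.exp (-V x)) = 1)
    (htend : Filter.Tendsto
      (fun x : EuclideanSpace ℝ (Fin n) =>
        (∑ i, (pd i V x) ^ 2) / 2 - ∑ i, pd i (pd i V) x)
      (Filter.cocompact (EuclideanSpace ℝ (Fin n))) Filter.atTop) :
    ∃ κ : ℝ, 0 < κ ∧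
      ∀ h : EuclideanSpace ℝ (Fin n) → ℝ, ContDiff ℝ 1 h →
        Integrable (fun x => (h x) ^ 2) (gibbs n V) →
        Integrable (fun x => ∑ i, (pd i h x) ^ 2) (gibbs n V) →
        (∫ x, (h x) ^ 2 ∂gibbs n V) - (∫ x, h x ∂gibbs n V) ^ 2
          ≤ κ⁻¹ * ∫ x, (∑ i, (pd i h x) ^ 2) ∂gibbs n V := by
  have hVc := hV.continuous
  have := isProbabilityMeasure_gibbs hnorm
  obtain ⟨R, K, hR, hK, hW⟩ := exists_lyapunov_bound hV htend
  obtain ⟨C, hC, hloc⟩ := exists_weighted_local_poincare V hVc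
    (isCompact_closedBall (0 : EuclideanSpace ℝ (Fin n)) R) (convex_closedBall _ _)
    (Metric.measure_closedBall_pos volume _ hR).ne'
  refine ⟨(8 + 2 * K * C)⁻¹, by positivity, fun h hh hi hid => ?_⟩
  obtain ⟨c, hc⟩ := hloc h hh
  have hL2 : MemLp h 2 (gibbs n V) :=
    (memLp_two_iff_integrable_sq hh.continuous.aestronglyMeasurable).2 hi
  have hic : Integrable (fun x => (h x - c) ^ 2) (gibbs n V) :=
    (hL2.sub (memLp_const c)).integrable_sq
  refine (integral_sq_sub_sq_integral_le hL2 c).trans ?_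
  rw [integrable_gibbs_iff hVc] at hic hid
  rw [integral_gibbs hVc, integral_gibbs hVc, inv_inv]
  have hglob := integral_sq_le_of_lyapunov hV (g := fun x => h x - c)
    (hh.sub contDiff_const) measurableSet_closedBall hK hW hic (by simpa only [pd_sub_const])
  simp only [pd_sub_const] at hglob
  have hset : ∫ x in Metric.closedBall 0 R, (∑ i, pd i h x ^ 2) * Real.exp (-V x) ≤
      ∫ x, (∑ i, pd i h x ^ 2) * Real.exp (-V x) :=
    setIntegral_le_integral hid (Filter.Eventually.of_forall fun x => by positivity)
  calc ∫ x, (h x - c) ^ 2 * Real.exp (-V x)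
      ≤ _ := hglob
    _ ≤ 8 * (∫ x, (∑ i, pd i h x ^ 2) * Real.exp (-V x)) +
          2 * K * (C * ∫ x, (∑ i, pd i h x ^ 2) * Real.exp (-V x)) := by
        gcongr
        exact hc.trans (by gcongr)
    _ = _ := by ring
end

section
/- Let V : ℝⁿ → ℝ be of class C² and assume there is C ≥ 0 such that |∇²V(x)| ≤ C(1 + |∇V(x)|) for all x ∈ ℝⁿ. Then for every compactly supported C¹ function g : ℝⁿ → ℝ: (i) ∫|∇V|² g² e^{−V} ≤ 8(1+√n·C)² ( ∫g² e^{−V} + ∫|∇g|² e^{−V} ); (ii) ∫|∇²V|² g² e^{−V} ≤ 16 C² (1+√(2n)·C)² ( ∫g² e^{−V} + ∫|∇g|² e^{−V} ). -/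
open MeasureTheory

section PartialDerivative

variable {n : ℕ}

theorem contDiff_pd {m k : WithTop ℕ∞} {f : EuclideanSpace ℝ (Fin n) → ℝ}
    (hf : ContDiff ℝ k f) (hmk : m + 1 ≤ k) (i : Fin n) : ContDiff ℝ m (pd i f) :=
  (hf.fderiv_right hmk).clm_apply contDiff_const

theorem pd_eq_zero_of_notMem_tsupport {f : EuclideanSpace ℝ (Fin n) → ℝ}
    {x : EuclideanSpace ℝ (Fin n)} (hx : x ∉ tsupport f) (i : Fin n) : pd i f x = 0 := by
  have h : fderiv ℝ f x = 0 := by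
    by_contra h
    exact hx (support_fderiv_subset ℝ h)
  simp [pd, h]

/-- Integration by parts against the weight `e^{-V}`. -/
theorem integral_pd_sq_mul_sq_mul_exp_neg {V g : EuclideanSpace ℝ (Fin n) → ℝ}
    (hV : ContDiff ℝ 2 V) (hg : ContDiff ℝ 1 g) (hgc : HasCompactSupport g) (i : Fin n) :
    ∫ x, (pd i V x) ^ 2 * (g x) ^ 2 * Real.exp (-V x) =
      ∫ x, (pd i (pd i V) x * (g x) ^ 2 + 2 * (g x * pd i g x * pd i V x))
        * Real.exp (-V x) := by
  have hV' : ContDiff ℝ 1 (pd i V) := contDiff_pd hV (by norm_num) i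
  have cV := hV.continuous
  have cg := hg.continuous
  have cV' := hV'.continuous
  have cV'' : Continuous (pd i (pd i V)) := (contDiff_pd (m := 0) hV' (by norm_num) i).continuous
  have cg' : Continuous (pd i g) := (contDiff_pd (m := 0) hg (by norm_num) i).continuous
  have h0 : ∀ x, x ∉ tsupport g → g x = 0 := fun x hx => image_eq_zero_of_notMem_tsupport hx
  have integrable_of_support : ∀ F : EuclideanSpace ℝ (Fin n) → ℝ, Continuous F →
      (∀ x, x ∉ tsupport g → F x = 0) → Integrable F := fun F hF hF0 =>
    hF.integrable_of_hasCompactSupport (HasCompactSupport.intro hgc hF0)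
  have dE : ∀ x, HasFDerivAt (fun x => Real.exp (-V x)) (Real.exp (-V x) • -fderiv ℝ V x) x :=
    fun x => ((hV.differentiable (by norm_num) x).hasFDerivAt.neg).exp
  have dW : ∀ x, HasFDerivAt (fun x => pd i V x * (g x * g x))
      (pd i V x • (g x • fderiv ℝ g x + g x • fderiv ℝ g x)
        + (g x * g x) • fderiv ℝ (pd i V) x) x := fun x =>
    (hV'.differentiable (by norm_num) x).hasFDerivAt.mul
      ((hg.differentiable (by norm_num) x).hasFDerivAt.mul
        (hg.differentiable (by norm_num) x).hasFDerivAt)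
  have eE : ∀ x, fderiv ℝ (fun x => Real.exp (-V x)) x (EuclideanSpace.single i 1)
      = -(Real.exp (-V x) * pd i V x) := fun x => by
    rw [(dE x).fderiv]; simp [pd]
  have eW : ∀ x, fderiv ℝ (fun x => pd i V x * (g x * g x)) x (EuclideanSpace.single i 1)
      = pd i V x * (g x * pd i g x + g x * pd i g x) + g x * g x * pd i (pd i V) x := fun x => by
    rw [(dW x).fderiv]; simp [pd, mul_add]
  have key := integral_mul_fderiv_eq_neg_fderiv_mul_of_integrable (μ := volume)
    (f := fun x => Real.exp (-V x)) (g := fun x => pd i V x * (g x * g x))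
    (v := EuclideanSpace.single i (1 : ℝ))
    (by simp only [eE]; exact integrable_of_support _ (by fun_prop) fun x hx => by simp [h0 x hx])
    (by simp only [eW]; exact integrable_of_support _ (by fun_prop) fun x hx => by simp [h0 x hx])
    (integrable_of_support _ (by fun_prop) fun x hx => by simp [h0 x hx])
    (fun x _ => (dE x).differentiableAt) (fun x _ => (dW x).differentiableAt)
  simp only [eE, eW] at key
  rw [← integral_neg] at key
  calc _ = _ := integral_congr_ae (.of_forall fun x => by ring)
    _ = _ := key.symm
    _ = _ := integral_congr_ae (.of_forall fun x => by ring)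

end PartialDerivative

section PointwiseEstimates

variable {n : ℕ}

theorem sum_diag_le_sqrt_mul_sqrt_sum_sq (H : Fin n → Fin n → ℝ) :
    ∑ i, H i i ≤ √n * √(∑ i, ∑ j, (H i j) ^ 2) := by
  rw [← Real.sqrt_mul (Nat.cast_nonneg n)]
  refine Real.le_sqrt_of_sq_le ?_
  calc (∑ i, H i i) ^ 2 ≤ n * ∑ i, (H i i) ^ 2 := by
        simpa using sq_sum_le_card_mul_sum_sq (s := Finset.univ) (f := fun i => H i i)
    _ ≤ n * ∑ i, ∑ j, (H i j) ^ 2 := by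
        gcongr with i
        exact Finset.single_le_sum (f := fun j => (H i j) ^ 2) (fun j _ => sq_nonneg _)
          (Finset.mem_univ i)

/-- If `|H| ≤ C (1 + |p|)`, the integrand produced by integration by parts can be absorbed. -/
theorem sum_diag_mul_sq_add_le {C : ℝ} (H : Fin n → Fin n → ℝ) (p q : Fin n → ℝ)
    (hH : √(∑ i, ∑ j, (H i j) ^ 2) ≤ C * (1 + √(∑ i, (p i) ^ 2))) (a : ℝ) :
    ∑ i, (H i i * a ^ 2 + 2 * (a * q i * p i)) ≤
      (√n * C + (√n * C) ^ 2) * a ^ 2 + 4 * ∑ i, (q i) ^ 2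
        + 1 / 2 * ((∑ i, (p i) ^ 2) * a ^ 2) := by
  have hP : 0 ≤ ∑ i, (p i) ^ 2 := by positivity
  have hs := Real.sq_sqrt hP
  set s := √(∑ i, (p i) ^ 2)
  set K := √n * C with hK
  have hD : ∑ i, H i i ≤ K * (1 + s) :=
    (sum_diag_le_sqrt_mul_sqrt_sum_sq H).trans
      ((mul_le_mul_of_nonneg_left hH (Real.sqrt_nonneg _)).trans_eq (by rw [hK]; ring))
  have hcross : ∑ i, 2 * (a * q i * p i) ≤
      4 * ∑ i, (q i) ^ 2 + 1 / 4 * ((∑ i, (p i) ^ 2) * a ^ 2) := by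
    rw [Finset.sum_mul, Finset.mul_sum, Finset.mul_sum, ← Finset.sum_add_distrib]
    exact Finset.sum_le_sum fun i _ => by nlinarith [sq_nonneg (2 * q i - 1 / 2 * (p i * a))]
  have hlap : (∑ i, H i i) * a ^ 2 ≤
      (K + K ^ 2) * a ^ 2 + 1 / 4 * ((∑ i, (p i) ^ 2) * a ^ 2) := by
    rw [← hs]
    calc (∑ i, H i i) * a ^ 2 ≤ (K + K ^ 2 + 1 / 4 * s ^ 2) * a ^ 2 := by
          gcongr
          nlinarith [sq_nonneg (K - 1 / 2 * s)]
      _ = _ := by ring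
  rw [Finset.sum_add_distrib, ← Finset.sum_mul]
  linarith

end PointwiseEstimates

/-- If `|∇²V| ≤ C(1 + |∇V|)` pointwise, then multiplication by `|∇V|` (resp. `|∇²V|`)
is bounded from `H¹(e^{-V})` to `L²(e^{-V})`, with the explicit constants
`8(1+√n C)²` and `16C²(1+√(2n) C)²`. -/
theorem gradV_relatively_bounded
    (n : ℕ) (V : EuclideanSpace ℝ (Fin n) → ℝ) (hV : ContDiff ℝ 2 V)
    (C : ℝ) (hC : 0 ≤ C)
    (hHess : ∀ x, Real.sqrt (∑ i, ∑ j, (pd i (pd j V) x) ^ 2)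
      ≤ C * (1 + Real.sqrt (∑ i, (pd i V x) ^ 2))) :
    ∀ g : EuclideanSpace ℝ (Fin n) → ℝ, ContDiff ℝ 1 g → HasCompactSupport g →
      ((∫ x, (∑ i, (pd i V x) ^ 2) * (g x) ^ 2 * Real.exp (-V x))
        ≤ 8 * (1 + Real.sqrt n * C) ^ 2 *
          ((∫ x, (g x) ^ 2 * Real.exp (-V x))
            + ∫ x, (∑ i, (pd i g x) ^ 2) * Real.exp (-V x))) ∧
      ((∫ x, (∑ i, ∑ j, (pd i (pd j V) x) ^ 2) * (g x) ^ 2 * Real.exp (-V x))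
        ≤ 16 * C ^ 2 * (1 + Real.sqrt (2 * n) * C) ^ 2 *
          ((∫ x, (g x) ^ 2 * Real.exp (-V x))
            + ∫ x, (∑ i, (pd i g x) ^ 2) * Real.exp (-V x))) := by
  intro g hg hgc
  have cV := hV.continuous
  have cg := hg.continuous
  have hV' : ∀ i, ContDiff ℝ 1 (pd i V) := contDiff_pd hV (by norm_num)
  have cV' : ∀ i, Continuous (pd i V) := fun i => (hV' i).continuous
  have cV'' : ∀ i j, Continuous (pd i (pd j V)) := fun i j =>
    (contDiff_pd (m := 0) (hV' j) (by norm_num) i).continuous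
  have cg' : ∀ i, Continuous (pd i g) := fun i =>
    (contDiff_pd (m := 0) hg (by norm_num) i).continuous
  have h0 : ∀ x, x ∉ tsupport g → g x = 0 := fun x hx => image_eq_zero_of_notMem_tsupport hx
  have integrable_of_support : ∀ F : EuclideanSpace ℝ (Fin n) → ℝ, Continuous F →
      (∀ x, x ∉ tsupport g → F x = 0) → Integrable F := fun F hF hF0 =>
    hF.integrable_of_hasCompactSupport (HasCompactSupport.intro hgc hF0)
  have iA : Integrable fun x => (∑ i, (pd i V x) ^ 2) * (g x) ^ 2 * Real.exp (-V x) :=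
    integrable_of_support _ (by fun_prop) fun x hx => by simp [h0 x hx]
  have iH : Integrable fun x =>
      (∑ i, ∑ j, (pd i (pd j V) x) ^ 2) * (g x) ^ 2 * Real.exp (-V x) :=
    integrable_of_support _ (by fun_prop) fun x hx => by simp [h0 x hx]
  have iG : Integrable fun x => (g x) ^ 2 * Real.exp (-V x) :=
    integrable_of_support _ (by fun_prop) fun x hx => by simp [h0 x hx]
  have iD : Integrable fun x => (∑ i, (pd i g x) ^ 2) * Real.exp (-V x) :=
    integrable_of_support _ (by fun_prop) fun x hx => by simp [pd_eq_zero_of_notMem_tsupport hx]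
  have iT : ∀ i, Integrable fun x =>
      (pd i (pd i V) x * (g x) ^ 2 + 2 * (g x * pd i g x * pd i V x)) * Real.exp (-V x) :=
    fun i => integrable_of_support _ (by fun_prop) fun x hx => by simp [h0 x hx]
  have iS : ∀ i, Integrable fun x => (pd i V x) ^ 2 * (g x) ^ 2 * Real.exp (-V x) :=
    fun i => integrable_of_support _ (by fun_prop) fun x hx => by simp [h0 x hx]
  have hparts : ∫ x, (∑ i, (pd i V x) ^ 2) * (g x) ^ 2 * Real.exp (-V x) =
      ∫ x, (∑ i, (pd i (pd i V) x * (g x) ^ 2 + 2 * (g x * pd i g x * pd i V x)))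
        * Real.exp (-V x) := by
    simp only [Finset.sum_mul]
    rw [integral_finsetSum _ fun i _ => iS i, integral_finsetSum _ fun i _ => iT i]
    exact Finset.sum_congr rfl fun i _ => integral_pd_sq_mul_sq_mul_exp_neg hV hg hgc i
  have hAbound : ∫ x, (∑ i, (pd i (pd i V) x * (g x) ^ 2 + 2 * (g x * pd i g x * pd i V x)))
        * Real.exp (-V x) ≤
      ∫ x, ((√n * C + (√n * C) ^ 2) * ((g x) ^ 2 * Real.exp (-V x))
        + 4 * ((∑ i, (pd i g x) ^ 2) * Real.exp (-V x))
        + 1 / 2 * ((∑ i, (pd i V x) ^ 2) * (g x) ^ 2 * Real.exp (-V x))) := by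
    refine integral_mono ?_ (((iG.const_mul _).add (iD.const_mul _)).add (iA.const_mul _))
      fun x => ?_
    · simp only [Finset.sum_mul]
      exact integrable_finsetSum _ fun i _ => iT i
    · have := mul_le_mul_of_nonneg_right (sum_diag_mul_sq_add_le (fun i j => pd i (pd j V) x)
        (fun i => pd i V x) (fun i => pd i g x) (hHess x) (g x)) (Real.exp_nonneg (-V x))
      linarith
  rw [integral_add (by exact (iG.const_mul _).add (iD.const_mul _)) (iA.const_mul _),
    integral_add (iG.const_mul _) (iD.const_mul _), integral_const_mul, integral_const_mul,
    integral_const_mul] at hAbound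
  have hHbound : ∫ x, (∑ i, ∑ j, (pd i (pd j V) x) ^ 2) * (g x) ^ 2 * Real.exp (-V x) ≤
      ∫ x, (2 * C ^ 2 * ((g x) ^ 2 * Real.exp (-V x))
        + 2 * C ^ 2 * ((∑ i, (pd i V x) ^ 2) * (g x) ^ 2 * Real.exp (-V x))) := by
    refine integral_mono iH ((iG.const_mul _).add (iA.const_mul _)) fun x => ?_
    have hs := Real.sq_sqrt (show 0 ≤ ∑ i, (pd i V x) ^ 2 by positivity)
    have h1 : ∑ i, ∑ j, (pd i (pd j V) x) ^ 2 ≤ 2 * C ^ 2 * (1 + ∑ i, (pd i V x) ^ 2) := by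
      refine ((Real.sqrt_le_left (by positivity)).1 (hHess x)).trans ?_
      nlinarith [mul_nonneg (sq_nonneg C) (sq_nonneg (1 - √(∑ i, (pd i V x) ^ 2)))]
    have h2 := mul_le_mul_of_nonneg_right h1
      (show 0 ≤ (g x) ^ 2 * Real.exp (-V x) by positivity)
    linarith
  rw [integral_add (iG.const_mul _) (iA.const_mul _), integral_const_mul,
    integral_const_mul] at hHbound
  have hG : 0 ≤ ∫ x, (g x) ^ 2 * Real.exp (-V x) := integral_nonneg fun x => by positivity
  have hD : 0 ≤ ∫ x, (∑ i, (pd i g x) ^ 2) * Real.exp (-V x) :=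
    integral_nonneg fun x => by positivity
  rw [← hparts] at hAbound
  set A := ∫ x, (∑ i, (pd i V x) ^ 2) * (g x) ^ 2 * Real.exp (-V x)
  set G := ∫ x, (g x) ^ 2 * Real.exp (-V x)
  set D := ∫ x, (∑ i, (pd i g x) ^ 2) * Real.exp (-V x)
  have hK : 0 ≤ √n * C := by positivity
  have hKL : √n * C ≤ √(2 * n) * C := by
    gcongr
    linarith [(Nat.cast_nonneg n : (0 : ℝ) ≤ n)]
  set K := √n * C
  set L := √(2 * n) * C
  have hA : A ≤ 2 * (K + K ^ 2) * G + 8 * D := by linarith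
  have hGA : ∀ M, K ≤ M → G + A ≤ 8 * (1 + M) ^ 2 * (G + D) := fun M hM => by
    have hM0 : 0 ≤ M := hK.trans hM
    have h1 : (1 + 2 * (K + K ^ 2)) * G ≤ 8 * (1 + M) ^ 2 * G := by
      gcongr
      nlinarith
    have h2 : 8 * D ≤ 8 * (1 + M) ^ 2 * D := by
      gcongr
      nlinarith
    linarith
  refine ⟨by linarith [hGA K le_rfl], hHbound.trans ?_⟩
  have := mul_le_mul_of_nonneg_left (hGA L hKL) (show 0 ≤ 2 * C ^ 2 by positivity)
  linarith
end

section
/- Let λ, μ ≥ 0 and λ', μ' > 0 satisfy λ/λ' + μ/μ' < 1, and set θ := (1 − (λ/λ' + μ/μ'))/(1 + (n/2)(1/λ' + 1/μ')). Then there is a constant C = C(n, λ, μ, λ', μ') such that for every measurable essentially bounded function φ : ℝⁿ×ℝⁿ → ℂ: ∫ |ξ|^{2λ}|η|^{2μ}|φ(ξ,η)|² dξ dη ≤ C ( ∫ |ξ|^{2λ'}|φ(ξ,η)|² dξ dη + ∫ |η|^{2μ'}|φ(ξ,η)|² dξ dη )^{1−θ} · ‖φ‖_∞^{2θ}. -/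
open MeasureTheory
open scoped ENNReal NNReal
open Filter Topology

/-- Optimizing the bound `L ≤ c M r ^ α + r ^ (-β) A` over the scale `r`. -/
lemma le_rpow_mul_rpow_of_forall_scale {L c M A : ℝ≥0∞} {α β : ℝ} (hα : 0 ≤ α) (hβ : 0 < β)
    (hc : c ≠ ⊤) (hM : M ≠ ⊤) (hM0 : M ≠ 0) (hA : α = 0 → A ≠ ⊤)
    (h : ∀ r : ℝ≥0∞, r ≠ 0 → r ≠ ⊤ → L ≤ c * M * r ^ α + r ^ (-β) * A) :
    L ≤ (c + 1) * A ^ (1 - β / (α + β)) * M ^ (β / (α + β)) := by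
  have hs : 0 < α + β := by linarith
  have hexp : 1 - β / (α + β) = α / (α + β) := by field_simp; ring
  have hMb : M ^ (β / (α + β)) ≠ 0 := by simp [ENNReal.rpow_eq_zero_iff, hM0, hM]
  rcases eq_or_ne A ⊤ with rfl | hAtop
  · have hα' : 0 < α := lt_of_le_of_ne hα fun h0 ↦ hA h0.symm rfl
    rw [hexp, ENNReal.top_rpow_of_pos (by positivity), ENNReal.mul_top (by simp),
      ENNReal.top_mul hMb]
    exact le_top
  rcases eq_or_ne A 0 with rfl | hA0
  · rcases hα.eq_or_lt with rfl | hα'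
    · have h1 := h 1 one_ne_zero ENNReal.one_ne_top
      simp only [zero_add, div_self hβ.ne', sub_self, ENNReal.rpow_zero, ENNReal.rpow_one,
        mul_one, mul_zero, add_zero] at h1 ⊢
      exact h1.trans (by gcongr; exact le_self_add)
    · have hlim : Tendsto (fun k : ℕ ↦ c * M * ((k : ℝ≥0∞)⁻¹) ^ α) atTop (𝓝 0) := by
        have h1 := (ENNReal.continuous_rpow_const (y := α)).tendsto 0 |>.comp
          ENNReal.tendsto_inv_nat_nhds_zero
        have h2 := ENNReal.Tendsto.const_mul h1 (Or.inr (ENNReal.mul_ne_top hc hM))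
        simpa [ENNReal.zero_rpow_of_pos hα', Function.comp_def] using h2
      refine (ge_of_tendsto hlim ?_).trans zero_le
      filter_upwards [eventually_ge_atTop 1] with k hk
      simpa using h (k : ℝ≥0∞)⁻¹ (by simp) (by simp; omega)
  · have hq0 : A / M ≠ 0 := by simp [ENNReal.div_eq_zero_iff, hA0, hM]
    have hqt : A / M ≠ ⊤ := ENNReal.div_ne_top hAtop hM0
    set r := (A / M) ^ (1 / (α + β)) with hr
    have hr0 : r ≠ 0 := by simp [hr, ENNReal.rpow_eq_zero_iff, hq0, hqt]
    have hrt : r ≠ ⊤ := by simp [hr, ENNReal.rpow_eq_top_iff, hq0, hqt]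
    have hMr : M * r ^ (α + β) = A := by
      rw [hr, ← ENNReal.rpow_mul, one_div, inv_mul_cancel₀ hs.ne', ENNReal.rpow_one,
        ENNReal.mul_div_cancel hM0 hM]
    have hrα : r ^ α = r ^ (α + β) * r ^ (-β) := by
      rw [← ENNReal.rpow_add _ _ hr0 hrt]; simp
    have hAr : A * r ^ (-β) = A ^ (1 - β / (α + β)) * M ^ (β / (α + β)) := by
      rw [hr, ← ENNReal.rpow_mul, show 1 / (α + β) * -β = -(β / (α + β)) by ring,
        ENNReal.rpow_neg, ← ENNReal.inv_rpow, ENNReal.inv_div (Or.inl hM) (Or.inl hM0),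
        ENNReal.div_rpow_of_nonneg _ _ (by positivity), ENNReal.rpow_sub _ _ hA0 hAtop,
        ENNReal.rpow_one]
      simp only [div_eq_mul_inv]
      ring
    calc L ≤ c * M * r ^ α + r ^ (-β) * A := h r hr0 hrt
      _ = c * (M * r ^ (α + β)) * r ^ (-β) + r ^ (-β) * A := by rw [hrα]; ring
      _ = (c + 1) * (A * r ^ (-β)) := by rw [hMr]; ring
      _ = _ := by rw [hAr, mul_assoc]

lemma rpow_mul_rpow_le_max_rpow {a b a' b' : ℝ} (ha : 0 ≤ a) (hb : 0 ≤ b) (ha' : 0 < a')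
    (hb' : 0 < b') (x y : ℝ≥0∞) :
    x ^ (2 * a) * y ^ (2 * b) ≤ max (x ^ a') (y ^ b') ^ (2 * (a / a' + b / b')) := by
  have hx : x ^ (2 * a) = (x ^ a') ^ (2 * (a / a')) := by
    rw [← ENNReal.rpow_mul]; congr 1; field_simp
  have hy : y ^ (2 * b) = (y ^ b') ^ (2 * (b / b')) := by
    rw [← ENNReal.rpow_mul]; congr 1; field_simp
  rw [hx, hy, mul_add, ENNReal.rpow_add_of_nonneg _ _ (by positivity) (by positivity)]
  gcongr
  · exact le_max_left _ _
  · exact le_max_right _ _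

lemma max_rpow_two_le_add (x y : ℝ≥0∞) (a' b' : ℝ) :
    max (x ^ a') (y ^ b') ^ (2 : ℝ) ≤ x ^ (2 * a') + y ^ (2 * b') := by
  rw [mul_comm 2 a', mul_comm 2 b', ENNReal.rpow_mul, ENNReal.rpow_mul]
  rcases max_choice (x ^ a') (y ^ b') with h | h <;> rw [h]
  · exact le_self_add
  · exact le_add_self

lemma rpow_le_rpow_sub_two_mul {N r : ℝ≥0∞} {s : ℝ} (hs : s < 1) (hr0 : r ≠ 0)
    (hN : N ≠ ⊤) (hrN : r ≤ N) :
    N ^ (2 * s) ≤ r ^ (-(2 * (1 - s))) * N ^ (2 : ℝ) := by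
  have hN0 : N ≠ 0 := fun h ↦ hr0 (le_zero_iff.mp (h ▸ hrN))
  rw [show 2 * s = -(2 * (1 - s)) + 2 by ring, ENNReal.rpow_add _ _ hN0 hN]
  gcongr ?_ * _
  rw [ENNReal.rpow_neg, ENNReal.rpow_neg]
  exact ENNReal.inv_le_inv.mpr (ENNReal.rpow_le_rpow hrN (by linarith))

/-- The anisotropic box `{|ξ| ^ a' ≤ r, |η| ^ b' ≤ r}`. -/
def anisotropicBox (n : ℕ) (a' b' : ℝ) (r : ℝ≥0∞) :
    Set (EuclideanSpace ℝ (Fin n) × EuclideanSpace ℝ (Fin n)) :=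
  {ξ | (‖ξ‖₊ : ℝ≥0∞) ^ a' ≤ r} ×ˢ {η | (‖η‖₊ : ℝ≥0∞) ^ b' ≤ r}

lemma measurableSet_anisotropicBox (n : ℕ) (a' b' : ℝ) (r : ℝ≥0∞) :
    MeasurableSet (anisotropicBox n a' b' r) :=
  (measurableSet_le (by fun_prop) measurable_const).prod
    (measurableSet_le (by fun_prop) measurable_const)

lemma volume_setOf_nnnorm_rpow_le (n : ℕ) {a' : ℝ} (ha' : 0 < a') {r : ℝ≥0∞} (hr : r ≠ ⊤) :
    volume {ξ : EuclideanSpace ℝ (Fin n) | (‖ξ‖₊ : ℝ≥0∞) ^ a' ≤ r} =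
      r ^ (n / a') * volume (Metric.ball (0 : EuclideanSpace ℝ (Fin n)) 1) := by
  have hrt : r ^ (1 / a') ≠ ⊤ := ENNReal.rpow_ne_top_of_nonneg (by positivity) hr
  have hset : {ξ : EuclideanSpace ℝ (Fin n) | (‖ξ‖₊ : ℝ≥0∞) ^ a' ≤ r} =
      Metric.closedBall 0 (r ^ (1 / a')).toReal := by
    ext ξ
    rw [Set.mem_ofPred_eq, mem_closedBall_zero_iff, one_div,
      ← ENNReal.le_rpow_inv_iff ha', ← one_div,
      ← ENNReal.ofReal_le_iff_le_toReal hrt, ofReal_norm]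
    rfl
  rw [hset, Measure.addHaar_closedBall _ _ ENNReal.toReal_nonneg, finrank_euclideanSpace_fin,
    ENNReal.ofReal_pow ENNReal.toReal_nonneg, ENNReal.ofReal_toReal hrt,
    ← ENNReal.rpow_natCast, ← ENNReal.rpow_mul]
  congr 2
  ring

lemma volume_anisotropicBox (n : ℕ) {a' b' : ℝ} (ha' : 0 < a') (hb' : 0 < b') {r : ℝ≥0∞}
    (hr : r ≠ ⊤) :
    volume (anisotropicBox n a' b' r) =
      volume (Metric.ball (0 : EuclideanSpace ℝ (Fin n)) 1) ^ 2 * r ^ (n * (1 / a' + 1 / b')) := by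
  rw [anisotropicBox, Measure.volume_eq_prod, Measure.prod_prod,
    volume_setOf_nnnorm_rpow_le n ha' hr, volume_setOf_nnnorm_rpow_le n hb' hr,
    show (n : ℝ) * (1 / a' + 1 / b') = n / a' + n / b' by ring,
    ENNReal.rpow_add_of_nonneg _ _ (by positivity) (by positivity)]
  ring

/-- Splitting the phase space into an anisotropic box of size `r` and its complement. -/
lemma lintegral_le_scale {n : ℕ} {a b a' b' : ℝ} (ha : 0 ≤ a) (hb : 0 ≤ b) (ha' : 0 < a')
    (hb' : 0 < b') (hsum : a / a' + b / b' < 1)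
    {w : EuclideanSpace ℝ (Fin n) × EuclideanSpace ℝ (Fin n) → ℝ≥0∞} (hw : Measurable w)
    {M : ℝ≥0∞} (hM : ∀ᵐ p, w p ≤ M) {r : ℝ≥0∞} (hr0 : r ≠ 0) (hr : r ≠ ⊤) :
    ∫⁻ p, (‖p.1‖₊ : ℝ≥0∞) ^ (2 * a) * (‖p.2‖₊ : ℝ≥0∞) ^ (2 * b) * w p ≤
      volume (Metric.ball (0 : EuclideanSpace ℝ (Fin n)) 1) ^ 2 * M *
          r ^ (2 * (a / a' + b / b') + n * (1 / a' + 1 / b')) +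
        r ^ (-(2 * (1 - (a / a' + b / b')))) *
          ((∫⁻ p, (‖p.1‖₊ : ℝ≥0∞) ^ (2 * a') * w p) +
            ∫⁻ p, (‖p.2‖₊ : ℝ≥0∞) ^ (2 * b') * w p) := by
  set s := a / a' + b / b' with hs
  have hs0 : 0 ≤ s := by positivity
  have hbound : ∀ᵐ p : EuclideanSpace ℝ (Fin n) × EuclideanSpace ℝ (Fin n),
      (‖p.1‖₊ : ℝ≥0∞) ^ (2 * a) * (‖p.2‖₊ : ℝ≥0∞) ^ (2 * b) * w p ≤
        (anisotropicBox n a' b' r).indicator (fun _ ↦ r ^ (2 * s) * M) p +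
          r ^ (-(2 * (1 - s))) * ((‖p.1‖₊ : ℝ≥0∞) ^ (2 * a') * w p +
            (‖p.2‖₊ : ℝ≥0∞) ^ (2 * b') * w p) := by
    filter_upwards [hM] with p hp
    have hmax := rpow_mul_rpow_le_max_rpow ha hb ha' hb' (‖p.1‖₊ : ℝ≥0∞) (‖p.2‖₊ : ℝ≥0∞)
    by_cases hmem : p ∈ anisotropicBox n a' b' r
    · rw [Set.indicator_of_mem hmem]
      refine le_add_right (mul_le_mul' (hmax.trans ?_) hp)
      exact ENNReal.rpow_le_rpow (max_le hmem.1 hmem.2) (by positivity)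
    · rw [Set.indicator_of_notMem hmem, zero_add, ← add_mul, ← mul_assoc]
      refine mul_le_mul_left ?_ _
      have hN : r ≤ max ((‖p.1‖₊ : ℝ≥0∞) ^ a') ((‖p.2‖₊ : ℝ≥0∞) ^ b') := by
        by_contra! hlt
        exact hmem ⟨(le_max_left _ _).trans hlt.le, (le_max_right _ _).trans hlt.le⟩
      have hNt : max ((‖p.1‖₊ : ℝ≥0∞) ^ a') ((‖p.2‖₊ : ℝ≥0∞) ^ b') ≠ ⊤ :=
        (max_lt (ENNReal.rpow_lt_top_of_nonneg ha'.le ENNReal.coe_ne_top)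
          (ENNReal.rpow_lt_top_of_nonneg hb'.le ENNReal.coe_ne_top)).ne
      refine hmax.trans ((rpow_le_rpow_sub_two_mul hsum hr0 hNt hN).trans ?_)
      gcongr
      exact max_rpow_two_le_add _ _ _ _
  refine (lintegral_mono_ae hbound).trans_eq ?_
  rw [lintegral_add_left (measurable_const.indicator (measurableSet_anisotropicBox n a' b' r)),
    lintegral_indicator_const (measurableSet_anisotropicBox n a' b' r),
    volume_anisotropicBox n ha' hb' hr, lintegral_const_mul _ (by fun_prop),
    lintegral_add_left (by fun_prop), ENNReal.rpow_add _ _ hr0 hr]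
  ring

/-- Fourier-space form of the anisotropic Nash-type interpolation inequality:
for `λ/λ' + μ/μ' < 1` and `θ = (1 - (λ/λ' + μ/μ'))/(1 + (n/2)(1/λ' + 1/μ'))`, there is a
constant `C = C(n, λ, μ, λ', μ')` such that for every measurable essentially bounded `φ`,
`∫ |ξ|^{2λ}|η|^{2μ}|φ|² ≤ C (∫ |ξ|^{2λ'}|φ|² + ∫ |η|^{2μ'}|φ|²)^{1-θ} ‖φ‖_∞^{2θ}`. -/
theorem anisotropic_nash_fourier
    (n : ℕ) (lam mu lam' mu' : ℝ)
    (hlam : 0 ≤ lam) (hmu : 0 ≤ mu) (hlam' : 0 < lam') (hmu' : 0 < mu')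
    (hsum : lam / lam' + mu / mu' < 1) :
    ∃ C : ℝ, 0 < C ∧
      ∀ φ : EuclideanSpace ℝ (Fin n) × EuclideanSpace ℝ (Fin n) → ℂ,
        Measurable φ → eLpNorm φ ⊤ volume < ⊤ →
        (∫⁻ p, (‖p.1‖₊ : ℝ≥0∞) ^ (2 * lam) * (‖p.2‖₊ : ℝ≥0∞) ^ (2 * mu)
            * (‖φ p‖₊ : ℝ≥0∞) ^ (2 : ℝ))
          ≤ ENNReal.ofReal C *
            ((∫⁻ p, (‖p.1‖₊ : ℝ≥0∞) ^ (2 * lam') * (‖φ p‖₊ : ℝ≥0∞) ^ (2 : ℝ))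
              + ∫⁻ p, (‖p.2‖₊ : ℝ≥0∞) ^ (2 * mu') * (‖φ p‖₊ : ℝ≥0∞) ^ (2 : ℝ)) ^
              (1 - (1 - (lam / lam' + mu / mu'))
                / (1 + (n : ℝ) / 2 * (1 / lam' + 1 / mu'))) *
            eLpNorm φ ⊤ volume ^
              (2 * ((1 - (lam / lam' + mu / mu'))
                / (1 + (n : ℝ) / 2 * (1 / lam' + 1 / mu')))) := by
  have hball : volume (Metric.ball (0 : EuclideanSpace ℝ (Fin n)) 1) ^ 2 ≠ ⊤ :=
    ENNReal.pow_ne_top measure_ball_lt_top.ne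
  set c := volume (Metric.ball (0 : EuclideanSpace ℝ (Fin n)) 1) ^ 2 with hc
  have hc1 : c + 1 ≠ ⊤ := ENNReal.add_ne_top.mpr ⟨hball, ENNReal.one_ne_top⟩
  refine ⟨(c + 1).toReal, ENNReal.toReal_pos (by simp) hc1, fun φ hφ hφt ↦ ?_⟩
  rw [ENNReal.ofReal_toReal hc1, ENNReal.rpow_mul]
  set K := eLpNorm φ ⊤ volume with hK
  have hs0 : 0 ≤ lam / lam' + mu / mu' := by positivity
  have hM : ∀ᵐ p, (‖φ p‖₊ : ℝ≥0∞) ^ (2 : ℝ) ≤ K ^ (2 : ℝ) := by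
    filter_upwards [ae_le_eLpNormEssSup (f := φ) (μ := volume)] with p hp
    rw [hK, eLpNorm_exponent_top]
    exact ENNReal.rpow_le_rpow hp zero_le_two
  rcases eq_or_ne K 0 with hK0 | hK0
  · refine le_of_eq_of_le ?_ zero_le
    refine lintegral_eq_zero_of_ae_eq_zero ?_
    filter_upwards [hM] with p hp
    rw [hK0, ENNReal.zero_rpow_of_pos two_pos, nonpos_iff_eq_zero] at hp
    simp [hp]
  set d := (n : ℝ) * (1 / lam' + 1 / mu') with hd
  have hd0 : 0 ≤ d := by positivity
  have hθ : (1 - (lam / lam' + mu / mu')) / (1 + (n : ℝ) / 2 * (1 / lam' + 1 / mu')) =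
      2 * (1 - (lam / lam' + mu / mu')) /
        (2 * (lam / lam' + mu / mu') + d + 2 * (1 - (lam / lam' + mu / mu'))) := by
    rw [show 2 * (lam / lam' + mu / mu') + d + 2 * (1 - (lam / lam' + mu / mu')) =
      2 * (1 + (n : ℝ) / 2 * (1 / lam' + 1 / mu')) by rw [hd]; ring,
      mul_div_mul_left _ _ two_ne_zero]
  rw [hθ]
  refine le_rpow_mul_rpow_of_forall_scale (by positivity) (by linarith) hball
    (ENNReal.rpow_ne_top_of_nonneg zero_le_two hφt.ne)
    (by simp [hK0]) (fun h0 ↦ ?_) fun r hr0 hr ↦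
      lintegral_le_scale hlam hmu hlam' hmu' hsum (by fun_prop) hM hr0 hr
  have hdz : d = 0 := by linarith
  have hn : n = 0 := by
    have hne : 1 / lam' + 1 / mu' ≠ 0 := by positivity
    exact Nat.cast_eq_zero.mp ((mul_eq_zero.mp hdz).resolve_right hne)
  subst hn
  have hzero (x : EuclideanSpace ℝ (Fin 0)) : ‖x‖₊ = 0 := by
    rw [Subsingleton.elim x 0, nnnorm_zero]
  simp [hzero, hlam', hmu']
end

section
/- Let K, Ē, k > 0 and let J ≥ 2 be an integer. Then there exist constants ε₁ > 0 (depending only on J), ℓ > 0 (depending only on J and k) and K₁ > 0 (depending only on K, Ē, k and J) with the following property: for every ε ∈ (0, ε₁) and every E ∈ (0, Ē) there exist real numbers a₀, a₁, …, a_{J−1} such that a₀ = 1 ≥ a₁ ≥ … ≥ a_{J−1} > 0; a₁ ≤ K·E^ε; a_j² ≤ K·a_{j−1}·a_{J−1}^{1+ε}·E^{kε} for every j ∈ {1, …, J−1}; and a_{J−1} ≥ K₁·E^{ℓε}. -/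
/-- Existence of the coefficients of the auxiliary Lyapunov functional:
given `J ≥ 2`, there is `ε₁ > 0` (depending only on `J`); given also `k > 0`, there is
`ℓ > 0` (depending only on `J` and `k`); given also `K, Ē > 0`, there is `K₁ > 0` such that
for all `0 < ε < ε₁` and `0 < E < Ē` there are `1 = a₀ ≥ a₁ ≥ … ≥ a_{J-1} > 0` with
`a₁ ≤ K E^ε`, `a_j² ≤ K a_{j-1} a_{J-1}^{1+ε} E^{kε}` for `1 ≤ j ≤ J-1`, and
`a_{J-1} ≥ K₁ E^{ℓε}`. -/
theorem exists_lyapunov_coefficients (J : ℕ) (hJ : 2 ≤ J) :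
    ∃ ε₁ : ℝ, 0 < ε₁ ∧
      ∀ k : ℝ, 0 < k →
        ∃ ℓ : ℝ, 0 < ℓ ∧
          ∀ K Ebar : ℝ, 0 < K → 0 < Ebar →
            ∃ K₁ : ℝ, 0 < K₁ ∧
              ∀ ε : ℝ, 0 < ε → ε < ε₁ →
                ∀ E : ℝ, 0 < E → E < Ebar →
                  ∃ a : ℕ → ℝ,
                    a 0 = 1 ∧
                    (∀ j, j + 1 ≤ J - 1 → a (j + 1) ≤ a j) ∧
                    (∀ j, j ≤ J - 1 → 0 < a j) ∧
                    a 1 ≤ K * E ^ ε ∧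
                    (∀ j, 1 ≤ j → j ≤ J - 1 →
                      (a j) ^ 2 ≤ K * a (j - 1) * (a (J - 1)) ^ ((1 : ℝ) + ε) * E ^ (k * ε)) ∧
                    K₁ * E ^ (ℓ * ε) ≤ a (J - 1) := by
  obtain ⟨N, rfl⟩ : ∃ N, J = N + 1 := ⟨J - 1, by omega⟩
  have hN : (1 : ℝ) ≤ 2 ^ N := one_le_pow₀ one_le_two
  have hN2 : (2 : ℝ) ≤ 2 ^ N := by
    simpa using pow_le_pow_right₀ (one_le_two (α := ℝ)) (show 1 ≤ N by omega)
  simp only [Nat.add_sub_cancel]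
  refine ⟨1 / (2 * 2 ^ N), by positivity, fun k hk => ⟨2 * (2 ^ N - 1) * (1 + k), ?_, ?_⟩⟩
  · have : (0 : ℝ) < 2 ^ N - 1 := by linarith
    positivity
  intro K Ebar hK _
  set B := Real.log (max Ebar 1)
  have hB0 : 0 ≤ B := Real.log_nonneg (le_max_right _ _)
  refine ⟨Real.exp (-(2 * (2 ^ N - 1) * ((1 + k) * B + |Real.log K|))), Real.exp_pos _, ?_⟩
  intro ε hε hε1 E hE hEb
  have hεN : ε * (2 * 2 ^ N) ≤ 1 := ((lt_div_iff₀ (by positivity)).1 hε1).le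
  have hε1' : ε ≤ 1 := by nlinarith
  have hEB : Real.log E ≤ B := Real.log_le_log hE (hEb.le.trans (le_max_left _ _))
  have hEpow (x : ℝ) : E ^ x = Real.exp (Real.log E * x) := Real.rpow_def_of_pos hE x
  have hKmul (x : ℝ) : K * Real.exp x = Real.exp (Real.log K + x) := by
    rw [Real.exp_add, Real.exp_log hK]
  set M := (1 + k) * ε * (B - Real.log E) + |Real.log K| with hM
  have hεL : 0 ≤ ε * (B - Real.log E) := mul_nonneg hε.le (by linarith)
  have hkεL : 0 ≤ k * (ε * (B - Real.log E)) := mul_nonneg hk.le hεL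
  have hεB : 0 ≤ ε * B := mul_nonneg hε.le hB0
  have hkεB : 0 ≤ k * (ε * B) := mul_nonneg hk.le hεB
  have hK0 := abs_nonneg (Real.log K)
  have hKabs := neg_abs_le (Real.log K)
  have hM0 : 0 ≤ M := by rw [hM]; linarith
  have hM1 : -M ≤ Real.log K + Real.log E * ε := by rw [hM]; linarith
  have hMk : -M ≤ Real.log K + Real.log E * (k * ε) := by rw [hM]; linarith
  have hMub : M ≤ (1 + k) * B + |Real.log K| - (1 + k) * ε * Real.log E := by
    have : (1 + k) * B * ε ≤ (1 + k) * B * 1 := by gcongr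
    rw [hM]; linarith
  have hhalf : (2 : ℝ) ^ N * (1 / 2) ^ N = 1 := by rw [← mul_pow]; norm_num
  have hlast : 2 * M * 2 ^ N * (1 - (1 / 2) ^ N) = 2 * M * (2 ^ N - 1) := by
    linear_combination (-2 * M) * hhalf
  refine ⟨fun j => Real.exp (-(2 * M * 2 ^ N * (1 - (1 / 2) ^ j))), by simp, ?_,
    fun _ _ => Real.exp_pos _, ?_, ?_, ?_⟩
  · intro j _
    have : ((1 : ℝ) / 2) ^ (j + 1) ≤ (1 / 2) ^ j :=
      pow_le_pow_of_le_one (by norm_num) (by norm_num) (Nat.le_succ j)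
    dsimp only
    gcongr
  · rw [hEpow, hKmul, Real.exp_le_exp]
    have := mul_le_mul_of_nonneg_left hN hM0
    linarith
  · intro j hj _
    obtain ⟨i, rfl⟩ : ∃ i, j = i + 1 := ⟨j - 1, by omega⟩
    dsimp only
    rw [hlast, hEpow, ← Real.exp_mul, ← Real.exp_nat_mul, hKmul, ← Real.exp_add, ← Real.exp_add,
      Real.exp_le_exp, Nat.add_sub_cancel, pow_succ]
    have hεM : ε * (2 * 2 ^ N) * M ≤ 1 * M := by gcongr
    have hεM0 : 0 ≤ ε * M := mul_nonneg hε.le hM0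
    push_cast
    linarith
  · dsimp only
    rw [hlast, hEpow, ← Real.exp_add, Real.exp_le_exp]
    have := mul_le_mul_of_nonneg_left hMub (show (0 : ℝ) ≤ 2 * (2 ^ N - 1) by linarith)
    linarith
end
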